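/- arXiv:2602.03348 — 4 statements merged into one kernel-verified Lean document; each statement's English description precedes it below -/
import Mathlib

section
/- The TV flux splitting exactly preserves isolated stationary contact waves: if U⁻ and U⁺ are admissible 1-D Euler states with u⁻ = u⁺ = 0 and equal pressures p⁻ = p⁺ = p (with arbitrary positive densities ρ⁻, ρ⁺), then u* = 0, p* = p, and the TV numerical flux equals F^A(U⁻,U⁺) + F^P(U⁻,U⁺) = (0, p, 0), independently of ρ⁻ and ρ⁺. -/
noncomputable section

namespace EulerCmp

/-- A 1-D Euler state in conserved variables `(ρ, ρu, E)`, recorded via `ρ`, `u`, `E`. -/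
structure State where
  ρ : ℝ
  u : ℝ
  E : ℝ

variable (γ : ℝ)

/-- Pressure from the equation of state `p = (γ-1)(E - ρ u²/2)`. -/
def pres (U : State) : ℝ := (γ - 1) * (U.E - U.ρ * U.u ^ 2 / 2)

/-- Admissibility: positive density and positive pressure. -/
def Admissible (U : State) : Prop := 0 < U.ρ ∧ 0 < pres γ U

/-- Sound speed `c = √(γ p / ρ)`. -/
def sound (U : State) : ℝ := Real.sqrt (γ * pres γ U / U.ρ)

/-- Conserved variable vector `U = (ρ, ρu, E)`. -/
def vec (U : State) : Fin 3 → ℝ := ![U.ρ, U.ρ * U.u, U.E]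

/-- Physical flux `F(U) = (ρu, ρu² + p, u(E+p))`. -/
def flux (U : State) : Fin 3 → ℝ :=
  ![U.ρ * U.u, U.ρ * U.u ^ 2 + pres γ U, U.u * (U.E + pres γ U)]

/-- TV splitting coefficient `C⁺(U) = ρ(u + √(u² + 4c²))`. -/
def Cplus (U : State) : ℝ := U.ρ * (U.u + Real.sqrt (U.u ^ 2 + 4 * (sound γ U) ^ 2))

/-- TV splitting coefficient `C⁻(U) = ρ(u − √(u² + 4c²))`. -/
def Cminus (U : State) : ℝ := U.ρ * (U.u - Real.sqrt (U.u ^ 2 + 4 * (sound γ U) ^ 2))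

/-- TV interface velocity `u*`, with `C⁺ = C⁺(U⁺)`, `C⁻ = C⁻(U⁻)`. -/
def uStarTV (Um Up : State) : ℝ :=
  (Cplus γ Up * Up.u - Cminus γ Um * Um.u) / (Cplus γ Up - Cminus γ Um)
    - 2 * (pres γ Up - pres γ Um) / (Cplus γ Up - Cminus γ Um)

/-- TV interface pressure `p*`, with `C⁺ = C⁺(U⁺)`, `C⁻ = C⁻(U⁻)`. -/
def pStarTV (Um Up : State) : ℝ :=
  (Cplus γ Up * pres γ Um - Cminus γ Um * pres γ Up) / (Cplus γ Up - Cminus γ Um)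
    + Cplus γ Up * Cminus γ Um * (Up.u - Um.u) / (2 * (Cplus γ Up - Cminus γ Um))

/-- TV advection flux `F^A`. -/
def fluxA (Um Up : State) : Fin 3 → ℝ :=
  if 0 ≤ uStarTV γ Um Up then
    uStarTV γ Um Up • ![Um.ρ, Um.ρ * Um.u, Um.ρ * Um.u ^ 2 / 2]
  else
    uStarTV γ Um Up • ![Up.ρ, Up.ρ * Up.u, Up.ρ * Up.u ^ 2 / 2]

/-- TV pressure flux `F^P = (0, p*, γ u* p*/(γ−1))`. -/
def fluxP (Um Up : State) : Fin 3 → ℝ :=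
  ![0, pStarTV γ Um Up, γ * uStarTV γ Um Up * pStarTV γ Um Up / (γ - 1)]

variable {γ} in
/-- The square root in the TV splitting coefficients strictly dominates `|u|`. -/
theorem abs_u_lt_sqrt (hγ : 1 < γ) {U : State} (hU : Admissible γ U) :
    |U.u| < Real.sqrt (U.u ^ 2 + 4 * (sound γ U) ^ 2) := by
  obtain ⟨hρ, hp⟩ := hU
  have hc : 0 < sound γ U := Real.sqrt_pos.mpr (by positivity)
  rw [← Real.sqrt_sq_eq_abs]
  exact Real.sqrt_lt_sqrt (sq_nonneg _) (lt_add_of_pos_right _ (by positivity))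

variable {γ} in
theorem Cplus_pos (hγ : 1 < γ) {U : State} (hU : Admissible γ U) : 0 < Cplus γ U :=
  mul_pos hU.1 (by linarith [abs_u_lt_sqrt hγ hU, neg_abs_le U.u])

variable {γ} in
theorem Cminus_neg (hγ : 1 < γ) {U : State} (hU : Admissible γ U) : Cminus γ U < 0 :=
  mul_neg_of_pos_of_neg hU.1 (by linarith [abs_u_lt_sqrt hγ hU, le_abs_self U.u])

/-- The TV flux splitting exactly preserves isolated stationary contact waves: if
`u⁻ = u⁺ = 0` and `p⁻ = p⁺ = p`, then `u* = 0`, `p* = p`, and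
`F^A(U⁻,U⁺) + F^P(U⁻,U⁺) = (0, p, 0)`, independently of the densities. -/
theorem tv_stationary_contact (hγ : 1 < γ) (Um Up : State)
    (hUm : Admissible γ Um) (hUp : Admissible γ Up)
    (hum : Um.u = 0) (hup : Up.u = 0) (hpp : pres γ Um = pres γ Up) :
    uStarTV γ Um Up = 0 ∧
    pStarTV γ Um Up = pres γ Um ∧
    fluxA γ Um Up + fluxP γ Um Up = ![0, pres γ Um, 0] := by
  have hC : Cplus γ Up - Cminus γ Um ≠ 0 :=
    (sub_pos.mpr ((Cminus_neg hγ hUm).trans (Cplus_pos hγ hUp))).ne'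
  have hu : uStarTV γ Um Up = 0 := by simp [uStarTV, hum, hup, hpp]
  have hp : pStarTV γ Um Up = pres γ Um := by
    rw [pStarTV, hum, hup, ← hpp, ← sub_mul, mul_div_cancel_left₀ _ hC]
    simp
  refine ⟨hu, hp, ?_⟩
  simp [fluxA, fluxP, hu, hp]

end EulerCmp
end
end

section
/- The HLLC numerical flux exactly preserves isolated stationary contact waves: if U⁻ and U⁺ are admissible 1-D Euler states with u⁻ = u⁺ = 0 and equal pressures p⁻ = p⁺ = p (with arbitrary positive densities ρ⁻, ρ⁺), then the contact speed satisfies a* = 0, the branch a⁻ ≤ 0 ≤ a* applies with intermediate state U*,⁻ = U⁻, and the HLLC flux equals F(U⁻) = (0, p, 0), independently of ρ⁻ and ρ⁺. -/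
noncomputable section

namespace EulerCmp

variable (γ : ℝ)

/-- HLL right one-sided speed `a⁺ = max{u⁺+c⁺, u⁻+c⁻}`. -/
def aP (Um Up : State) : ℝ := max (Up.u + sound γ Up) (Um.u + sound γ Um)

/-- HLL left one-sided speed `a⁻ = min{u⁺−c⁺, u⁻−c⁻}`. -/
def aM (Um Up : State) : ℝ := min (Up.u - sound γ Up) (Um.u - sound γ Um)

/-- HLLC contact speed `a*`. -/
def aStar (Um Up : State) : ℝ :=
  (pres γ Up - pres γ Um + Um.ρ * Um.u * (aM γ Um Up - Um.u)
    - Up.ρ * Up.u * (aP γ Um Up - Up.u)) /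
  (Um.ρ * (aM γ Um Up - Um.u) - Up.ρ * (aP γ Um Up - Up.u))

/-- HLLC left intermediate state `U*,⁻ = U⁻ (a⁻ − u⁻)/(a⁻ − a*)`. -/
def uStarM (Um Up : State) : Fin 3 → ℝ :=
  ((aM γ Um Up - Um.u) / (aM γ Um Up - aStar γ Um Up)) • vec Um

/-- HLLC right intermediate state `U*,⁺ = U⁺ (a⁺ − u⁺)/(a⁺ − a*)`. -/
def uStarP (Um Up : State) : Fin 3 → ℝ :=
  ((aP γ Um Up - Up.u) / (aP γ Um Up - aStar γ Um Up)) • vec Up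

/-- The HLLC numerical flux with its four branches. -/
def hllcFlux (Um Up : State) : Fin 3 → ℝ :=
  if 0 ≤ aM γ Um Up then flux γ Um
  else if aM γ Um Up ≤ 0 ∧ 0 ≤ aStar γ Um Up then
    flux γ Um + aM γ Um Up • (uStarM γ Um Up - vec Um)
  else if aStar γ Um Up ≤ 0 ∧ 0 ≤ aP γ Um Up then
    flux γ Up + aP γ Um Up • (uStarP γ Um Up - vec Up)
  else flux γ Up

/-- The sound speed of an admissible state is positive. -/
theorem sound_pos {γ : ℝ} (hγ : 0 < γ) {U : State} (hU : Admissible γ U) : 0 < sound γ U :=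
  Real.sqrt_pos.mpr (div_pos (mul_pos hγ hU.2) hU.1)

/-- The left HLL speed is negative when the left state is admissible and at rest. -/
theorem aM_neg {γ : ℝ} (hγ : 0 < γ) {Um Up : State} (hUm : Admissible γ Um)
    (hum : Um.u = 0) : aM γ Um Up < 0 :=
  min_lt_of_right_lt (by linarith [sound_pos hγ hUm])

/-- With both velocities zero and equal pressures, the HLLC contact speed vanishes. -/
theorem aStar_eq_zero {γ : ℝ} {Um Up : State} (hum : Um.u = 0) (hup : Up.u = 0)
    (hpp : pres γ Um = pres γ Up) : aStar γ Um Up = 0 := by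
  simp [aStar, hum, hup, hpp]

/-- The HLLC numerical flux exactly preserves isolated stationary contact waves: if
`u⁻ = u⁺ = 0` and `p⁻ = p⁺ = p`, then `a* = 0`, the branch `a⁻ ≤ 0 ≤ a*` applies with
intermediate state `U*,⁻ = U⁻`, and the HLLC flux equals `F(U⁻) = (0, p, 0)`,
independently of the densities. -/
theorem hllc_stationary_contact (hγ : 1 < γ) (Um Up : State)
    (hUm : Admissible γ Um) (hUp : Admissible γ Up)
    (hum : Um.u = 0) (hup : Up.u = 0) (hpp : pres γ Um = pres γ Up) :
    aStar γ Um Up = 0 ∧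
    aM γ Um Up ≤ 0 ∧ 0 ≤ aStar γ Um Up ∧
    uStarM γ Um Up = vec Um ∧
    hllcFlux γ Um Up = flux γ Um ∧
    flux γ Um = ![0, pres γ Um, 0] := by
  have ha : aM γ Um Up < 0 := aM_neg (by linarith) hUm hum
  have hs : aStar γ Um Up = 0 := aStar_eq_zero hum hup hpp
  have hU : uStarM γ Um Up = vec Um := by
    simp [uStarM, hs, hum, div_self ha.ne]
  refine ⟨hs, ha.le, hs.ge, hU, ?_, ?_⟩
  · rw [hllcFlux, if_neg ha.not_ge, if_pos ⟨ha.le, hs.ge⟩, hU, sub_self, smul_zero, add_zero]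
  · simp [flux, hum]

end EulerCmp
end
end

section
/- The shifted six-point stencil is a fourth-order approximation of the second derivative at the midpoint: let f : ℝ → ℝ be six times continuously differentiable and fix x ∈ ℝ. Then (1/(48h²))·[−5f(x−2h) + 39f(x−h) − 34f(x) − 34f(x+h) + 39f(x+2h) − 5f(x+3h)] − f''(x + h/2) = O(h⁴) as h → 0. -/
open Topology Asymptotics Filter

/-- Taylor's theorem with a big-O remainder, along the dilated increment `c * h`. -/
theorem ContDiff.sub_taylor_sum_isBigO {f : ℝ → ℝ} {n : ℕ} (hf : ContDiff ℝ n f) (x c : ℝ) :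
    (fun h : ℝ => f (x + c * h)
        - ∑ k ∈ Finset.range n, iteratedDeriv k f x / (k.factorial : ℝ) * (c * h) ^ k)
      =O[𝓝 0] fun h => h ^ n := by
  have ht : Tendsto (fun h : ℝ => x + c * h) (𝓝 0) (𝓝 x) :=
    Continuous.tendsto' (by fun_prop) _ _ (by simp)
  have h_pow : (fun h : ℝ => (c * h) ^ n) =O[𝓝 0] fun h => h ^ n := by
    simp only [mul_pow]
    exact (isBigO_refl _ _).const_mul_left _
  have h_rem := ((taylor_isLittleO_univ (x₀ := x) hf).comp_tendsto ht).isBigO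
  simp only [Function.comp_def, add_sub_cancel_left, taylor_within_apply,
    iteratedDerivWithin_univ, smul_eq_mul, Finset.sum_range_succ] at h_rem
  have h_top := h_pow.const_mul_left (iteratedDeriv n f x / (n.factorial : ℝ))
  refine ((h_rem.trans h_pow).add h_top).congr_left fun h => ?_
  have h_sum : ∑ k ∈ Finset.range n, ((k.factorial : ℝ))⁻¹ * (c * h) ^ k * iteratedDeriv k f x
      = ∑ k ∈ Finset.range n, iteratedDeriv k f x / (k.factorial : ℝ) * (c * h) ^ k :=
    Finset.sum_congr rfl fun k _ => by ring
  rw [h_sum]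
  ring

/-- The shifted six-point stencil is a fourth-order approximation of the second
derivative at the midpoint: for `f ∈ C⁶`,
`(1/(48h²))(−5f(x−2h) + 39f(x−h) − 34f(x) − 34f(x+h) + 39f(x+2h) − 5f(x+3h))
  − f''(x + h/2) = O(h⁴)` as `h → 0`. -/
theorem sixpoint_second_derivative_midpoint (f : ℝ → ℝ) (hf : ContDiff ℝ 6 f) (x : ℝ) :
    (fun h : ℝ =>
        (1 / (48 * h ^ 2)) * (-5 * f (x - 2 * h) + 39 * f (x - h) - 34 * f x
          - 34 * f (x + h) + 39 * f (x + 2 * h) - 5 * f (x + 3 * h))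
        - iteratedDeriv 2 f (x + h / 2))
      =O[𝓝[≠] (0 : ℝ)] fun h => h ^ 4 := by
  have hf'' : ContDiff ℝ (4 : ℕ) (iteratedDeriv 2 f) := by
    rw [iteratedDeriv_eq_iterate]
    exact ContDiff.iterate_deriv' 4 2 hf
  have h_deriv (k : ℕ) : iteratedDeriv k (iteratedDeriv 2 f) x = iteratedDeriv (k + 2) f x := by
    simp only [iteratedDeriv_eq_iterate, Function.iterate_add_apply]
  have R (c : ℝ) := (ContDiff.sub_taylor_sum_isBigO (n := 6) hf x c).mono
    (nhdsWithin_le_nhds (s := {0}ᶜ))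
  have S := (hf''.sub_taylor_sum_isBigO x (1 / 2)).mono (nhdsWithin_le_nhds (s := {0}ᶜ))
  have N := (((((R (-2)).const_mul_left (-5)).add ((R (-1)).const_mul_left 39)).add
    ((R 0).const_mul_left (-34))).add ((R 1).const_mul_left (-34))).add
    ((R 2).const_mul_left 39) |>.add ((R 3).const_mul_left (-5))
  have Q := (isBigO_refl (fun h : ℝ => 1 / (48 * h ^ 2)) (𝓝[≠] 0)).mul N
  have Q' : (fun h : ℝ => 1 / (48 * h ^ 2) * h ^ 6) =O[𝓝[≠] 0] fun h => h ^ 4 := by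
    refine ((isBigO_refl (fun h : ℝ => h ^ 4) _).const_mul_left (1 / 48)).congr' ?_ .rfl
    filter_upwards [self_mem_nhdsWithin] with h (hh : h ≠ 0)
    field_simp
  refine ((Q.trans Q').sub S).congr' ?_ .rfl
  filter_upwards [self_mem_nhdsWithin] with h (hh : h ≠ 0)
  simp only [Finset.sum_range_succ, Finset.sum_range_zero, h_deriv, Nat.factorial]
  rw [show x + -2 * h = x - 2 * h by ring, show x + -1 * h = x - h by ring,
    show x + 0 * h = x by ring, show x + 1 * h = x + h by ring,
    show x + 1 / 2 * h = x + h / 2 by ring]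
  push_cast
  field_simp
  ring
end

section
/- The shifted six-point stencil is a second-order approximation of the fourth derivative at the midpoint: let f : ℝ → ℝ be six times continuously differentiable and fix x ∈ ℝ. Then (1/(2h⁴))·[f(x−2h) − 3f(x−h) + 2f(x) + 2f(x+h) − 3f(x+2h) + f(x+3h)] − f''''(x + h/2) = O(h²) as h → 0. -/
open Topology Asymptotics Filter

/-- Peano form of Taylor's formula, along the line `h ↦ x + c * h`. -/
theorem taylor_isBigO_comp_const_mul {f : ℝ → ℝ} {n : ℕ} (hf : ContDiff ℝ n f) (x c : ℝ) :
    (fun h : ℝ => f (x + c * h)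
        - ∑ k ∈ Finset.range (n + 1), iteratedDeriv k f x * (c * h) ^ k / (k.factorial : ℝ))
      =O[𝓝 0] fun h => h ^ n := by
  have ht : Tendsto (fun h : ℝ => x + c * h) (𝓝 0) (𝓝 x) := by
    have : Continuous fun h : ℝ => x + c * h := by fun_prop
    simpa using this.tendsto 0
  have h1 := ((taylor_isLittleO_univ (x₀ := x) hf).comp_tendsto ht).isBigO
  have h2 : (fun h : ℝ => (c * h) ^ n) =O[𝓝 0] fun h => h ^ n := by
    simpa only [mul_pow] using (isBigO_refl (fun h : ℝ => h ^ n) (𝓝 0)).const_mul_left (c ^ n)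
  refine (h1.congr (fun h => ?_) (fun h => ?_)).trans h2
  · simp only [Function.comp_apply, taylor_within_apply, iteratedDerivWithin_univ, smul_eq_mul,
      add_sub_cancel_left]
    congr 1
    exact Finset.sum_congr rfl fun k _ => by ring
  · simp

/-- The shifted six-point stencil is a second-order approximation of the fourth
derivative at the midpoint: for `f ∈ C⁶`,
`(1/(2h⁴))(f(x−2h) − 3f(x−h) + 2f(x) + 2f(x+h) − 3f(x+2h) + f(x+3h))
  − f''''(x + h/2) = O(h²)` as `h → 0`. -/
theorem sixpoint_fourth_derivative_midpoint (f : ℝ → ℝ) (hf : ContDiff ℝ 6 f) (x : ℝ) :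
    (fun h : ℝ =>
        (1 / (2 * h ^ 4)) * (f (x - 2 * h) - 3 * f (x - h) + 2 * f x
          + 2 * f (x + h) - 3 * f (x + 2 * h) + f (x + 3 * h))
        - iteratedDeriv 4 f (x + h / 2))
      =O[𝓝[≠] (0 : ℝ)] fun h => h ^ 2 := by
  have T (c : ℝ) := taylor_isBigO_comp_const_mul (n := 6) hf x c
  have hf4 : ContDiff ℝ (2 : ℕ) (iteratedDeriv 4 f) := by
    rw [iteratedDeriv_eq_iterate]
    exact ContDiff.iterate_deriv' 2 4 hf
  have hd (k : ℕ) : iteratedDeriv k (iteratedDeriv 4 f) = iteratedDeriv (k + 4) f := by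
    simp only [iteratedDeriv_eq_iterate, Function.iterate_add_apply]
  have D := (taylor_isBigO_comp_const_mul hf4 x (1 / 2)).mono (nhdsWithin_le_nhds (s := {0}ᶜ))
  have S := ((((((T (-2)).sub ((T (-1)).const_mul_left 3)).add ((T 1).const_mul_left 2)).sub
    ((T 2).const_mul_left 3)).add (T 3))).mono (nhdsWithin_le_nhds (s := {0}ᶜ))
  have Q := (isBigO_refl (fun h : ℝ => 1 / (2 * h ^ 4)) (𝓝[≠] 0)).mul S
  have hQ : (fun h : ℝ => 1 / (2 * h ^ 4) * h ^ 6) =O[𝓝[≠] 0] fun h => h ^ 2 := by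
    refine ((isBigO_refl (fun h : ℝ => h ^ 2) (𝓝[≠] 0)).const_mul_left (1 / 2)).congr' ?_
      EventuallyEq.rfl
    filter_upwards [self_mem_nhdsWithin] with h (hh : h ≠ 0)
    field_simp
  have C := (isBigO_refl (fun h : ℝ => h ^ 2) (𝓝[≠] 0)).const_mul_left
    (7 / 24 * iteratedDeriv 6 f x)
  refine (((Q.trans hQ).sub D).add C).congr' ?_ EventuallyEq.rfl
  filter_upwards [self_mem_nhdsWithin] with h (hh : h ≠ 0)
  simp only [hd, Finset.sum_range_succ, Finset.sum_range_zero, Nat.factorial, iteratedDeriv_zero]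
  rw [show x - 2 * h = x + -2 * h by ring, show x - h = x + -1 * h by ring,
    show x + h = x + 1 * h by ring, show x + h / 2 = x + 1 / 2 * h by ring]
  push_cast
  field_simp
  ring
end
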